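/- arXiv:1912.01049 — 10 statements merged into one kernel-verified Lean document; each statement's English description precedes it below -/
import Mathlib

section
/- Let (m, M) be a 2-additive Möbius representation on n criteria satisfying the boundary condition and the monotonicity condition. Define the induced capacity μ on subsets of criteria by μ(S) = ∑_{j ∈ S} m j + ∑_{j < s, j ∈ S, s ∈ S} M j s. Then μ(∅) = 0, μ of the full set of criteria equals 1, and μ is monotone: for all subsets S ⊆ T of criteria, μ(S) ≤ μ(T). -/
open Finset

/-- Adding an index `a` to `S` adds exactly the terms pairing `a` with the elements of `S`. -/
theorem sum_lt_pairs_insert {ι R : Type*} [LinearOrder ι] [AddCommMonoid R] {M : ι → ι → R}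
    (hsymm : ∀ j s, M j s = M s j) {a : ι} {S : Finset ι} (ha : a ∉ S) :
    ∑ j ∈ insert a S, ∑ s ∈ insert a S, (if j < s then M j s else 0) =
      ∑ s ∈ S, M a s + ∑ j ∈ S, ∑ s ∈ S, (if j < s then M j s else 0) := by
  simp only [Finset.sum_insert ha, Finset.sum_add_distrib, lt_irrefl, if_false, zero_add]
  rw [← add_assoc, ← Finset.sum_add_distrib]
  congr 1
  refine Finset.sum_congr rfl fun s hs => ?_
  rcases lt_or_gt_of_ne (ne_of_mem_of_not_mem hs ha) with h | h
  · simp [h, h.not_gt, hsymm s a]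
  · simp [h, h.not_gt]

/-- the capacity induced by a 2-additive Möbius representation satisfying
the boundary and monotonicity conditions is a normalized monotone capacity. -/
theorem flowsort_choquet_capacity (n : ℕ) (m : Fin n → ℝ) (M : Fin n → Fin n → ℝ)
    (hsymm : ∀ j s, M j s = M s j) (hdiag : ∀ j, M j j = 0)
    (hbound : ∑ j, m j + ∑ j, ∑ s, (if j < s then M j s else 0) = 1)
    (hmono1 : ∀ j, 0 ≤ m j)
    (hmono2 : ∀ j (S : Finset (Fin n)), j ∉ S → 0 ≤ m j + ∑ s ∈ S, M j s)
    (μ : Finset (Fin n) → ℝ)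
    (hμ : ∀ S : Finset (Fin n),
      μ S = ∑ j ∈ S, m j + ∑ j ∈ S, ∑ s ∈ S, (if j < s then M j s else 0)) :
    μ ∅ = 0 ∧ μ Finset.univ = 1 ∧
      ∀ S T : Finset (Fin n), S ⊆ T → μ S ≤ μ T := by
  refine ⟨by simp [hμ], by rw [hμ, hbound], ?_⟩
  have h_insert : ∀ a S, a ∉ S → μ S ≤ μ (insert a S) := by
    intro a S ha
    rw [hμ, hμ, sum_lt_pairs_insert hsymm ha, Finset.sum_insert ha]
    linarith [hmono2 a S ha]
  have h_union : ∀ S U, μ S ≤ μ (U ∪ S) := by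
    intro S U
    induction U using Finset.induction_on with
    | empty => simp
    | insert a U _ ih =>
      rw [Finset.insert_union]
      by_cases ha : a ∈ U ∪ S
      · rwa [Finset.insert_eq_of_mem ha]
      · exact ih.trans (h_insert a _ ha)
  intro S T hST
  simpa [Finset.union_eq_left.mpr hST] using h_union S T
end

section
/- Let (m, M) be a 2-additive Möbius representation on n criteria, and for each criterion j let I j = m j + (1/2) ∑_{s ≠ j} M j s be its Shapley index. Then for every vector P : Fin n → ℝ, the 2-additive Choquet integral satisfies the identity CI(P) = ∑_{j < s, M j s > 0} min(P j, P s) · M j s + ∑_{j < s, M j s < 0} max(P j, P s) · |M j s| + ∑_j P j · (I j − (1/2) ∑_{s ≠ j} |M j s|). -/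
open Finset

/-- The 2-additive Choquet integral (Möbius form). -/
noncomputable def CI2 (n : ℕ) (m : Fin n → ℝ) (M : Fin n → Fin n → ℝ)
    (P : Fin n → ℝ) : ℝ :=
  ∑ j, m j * P j + ∑ j, ∑ s, if j < s then M j s * min (P j) (P s) else 0

/-- A weighted sum of the rows of a symmetric matrix with zero diagonal, as a sum over pairs. -/
theorem sum_sum_mul_eq_sum_lt {ι : Type*} [Fintype ι] [LinearOrder ι] (W : ι → ι → ℝ)
    (hsymm : ∀ j s, W j s = W s j) (hdiag : ∀ j, W j j = 0) (P : ι → ℝ) :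
    ∑ j, ∑ s, P j * W j s = ∑ j, ∑ s, if j < s then (P j + P s) * W j s else 0 := by
  have hsplit : ∀ j s, P j * W j s =
      (if j < s then P j * W j s else 0) + if s < j then P j * W s j else 0 := by
    intro j s
    rcases lt_trichotomy j s with h | rfl | h
    · simp [h, h.not_gt]
    · simp [hdiag]
    · simp [h, h.not_gt, hsymm j s]
  rw [sum_congr rfl fun j _ => sum_congr rfl fun s _ => hsplit j s]
  simp_rw [sum_add_distrib]
  rw [sum_comm (f := fun j s => if s < j then P j * W s j else 0)]
  simp_rw [← sum_add_distrib]
  refine sum_congr rfl fun j _ => sum_congr rfl fun s _ => ?_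
  split_ifs <;> ring

/-- the 2-additive Choquet integral rewritten in terms of the Shapley and
interaction indexes. -/
theorem choquet_shapley_form (n : ℕ) (m : Fin n → ℝ) (M : Fin n → Fin n → ℝ)
    (hsymm : ∀ j s, M j s = M s j) (hdiag : ∀ j, M j j = 0)
    (I : Fin n → ℝ)
    (hI : ∀ j, I j = m j + (1 / 2) * ∑ s ∈ Finset.univ.erase j, M j s)
    (P : Fin n → ℝ) :
    CI2 n m M P =
      (∑ j, ∑ s, if j < s ∧ 0 < M j s then min (P j) (P s) * M j s else 0)
      + (∑ j, ∑ s, if j < s ∧ M j s < 0 then max (P j) (P s) * |M j s| else 0)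
      + ∑ j, P j * (I j - (1 / 2) * ∑ s ∈ Finset.univ.erase j, |M j s|) := by
  have herase : ∀ j, P j * (I j - (1 / 2) * ∑ s ∈ univ.erase j, |M j s|) =
      m j * P j + ∑ s, P j * ((M j s - |M j s|) / 2) := by
    intro j
    rw [hI, sum_erase _ (hdiag j), sum_erase _ (by simp [hdiag]), ← mul_sum, ← sum_div,
      sum_sub_distrib]
    ring
  simp_rw [CI2, herase, sum_add_distrib]
  rw [sum_sum_mul_eq_sum_lt (fun j s => (M j s - |M j s|) / 2)
    (fun j s => by simp only [hsymm j s]) (fun j => by simp [hdiag]) P, add_left_comm]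
  congr 1
  simp_rw [← sum_add_distrib]
  refine sum_congr rfl fun j _ => sum_congr rfl fun s _ => ?_
  by_cases hjs : j < s
  · rcases lt_trichotomy (M j s) 0 with h | h | h
    · simp only [hjs, h, h.not_gt, and_true, and_false, if_true, if_false, abs_of_neg h]
      linear_combination M j s * min_add_max (P j) (P s)
    · simp [h]
    · simp only [hjs, h, h.not_gt, and_true, and_false, if_true, if_false, abs_of_pos h]
      ring
  · simp [hjs]
end

section
/- Let (m, M) be a 2-additive Möbius representation on n criteria and for each criterion j let I j = m j + (1/2) ∑_{s ≠ j} M j s be its Shapley index. If I j − (1/2) ∑_{s ≠ j} |M j s| ≥ 0 for every criterion j, then the monotonicity condition holds: m j ≥ 0 for every j, and m j + ∑_{s ∈ S} M j s ≥ 0 for every j and every finite set S of criteria with j ∉ S. -/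
open Finset

/-- Every partial sum of `f` over `T` is at least minus the sum over `T` of the negative parts. -/
theorem half_sum_sub_sum_abs_le_sum_of_subset {ι : Type*} (f : ι → ℝ) {S T : Finset ι}
    (h : S ⊆ T) : (1 / 2) * ∑ s ∈ T, f s - (1 / 2) * ∑ s ∈ T, |f s| ≤ ∑ s ∈ S, f s := by
  have hT : ∑ s ∈ S, (|f s| - f s) ≤ ∑ s ∈ T, (|f s| - f s) :=
    Finset.sum_le_sum_of_subset_of_nonneg h fun s _ _ => sub_nonneg.2 (le_abs_self _)
  have hS : -∑ s ∈ S, f s ≤ ∑ s ∈ S, |f s| := by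
    rw [← Finset.sum_neg_distrib]
    exact Finset.sum_le_sum fun s _ => neg_le_abs _
  simp only [Finset.sum_sub_distrib] at hT
  linarith

/-- if the Shapley-index restrictions `I j - (1/2) ∑_{s ≠ j} |M j s| ≥ 0`
hold, then the Möbius monotonicity condition holds. -/
theorem shapley_restriction_implies_monotonicity (n : ℕ)
    (m : Fin n → ℝ) (M : Fin n → Fin n → ℝ)
    (hsymm : ∀ j s, M j s = M s j) (hdiag : ∀ j, M j j = 0)
    (I : Fin n → ℝ)
    (hI : ∀ j, I j = m j + (1 / 2) * ∑ s ∈ Finset.univ.erase j, M j s)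
    (hres : ∀ j, 0 ≤ I j - (1 / 2) * ∑ s ∈ Finset.univ.erase j, |M j s|) :
    (∀ j, 0 ≤ m j) ∧
      ∀ j (S : Finset (Fin n)), j ∉ S → 0 ≤ m j + ∑ s ∈ S, M j s := by
  have key : ∀ j (S : Finset (Fin n)), j ∉ S → 0 ≤ m j + ∑ s ∈ S, M j s := by
    intro j S hj
    have hsub : S ⊆ Finset.univ.erase j :=
      Finset.subset_erase.2 ⟨Finset.subset_univ S, hj⟩
    linarith [half_sum_sub_sum_abs_le_sum_of_subset (M j) hsub, hI j, hres j]
  exact ⟨fun j => by simpa using key j ∅ (Finset.notMem_empty j), key⟩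
end

section
/- Let (m, M) be a 2-additive Möbius representation on n criteria satisfying the monotonicity condition. Then the 2-additive Choquet integral is monotone in its arguments: for all vectors P, Q : Fin n → ℝ with P j ≤ Q j for every criterion j, one has CI(P) ≤ CI(Q). -/
open Finset

/-- Monotonicity of the 2-additive Choquet integral when a single criterion `i` is raised. -/
theorem CI2_le_CI2_of_eq_off {n : ℕ} {m : Fin n → ℝ} {M : Fin n → Fin n → ℝ}
    (hsymm : ∀ j s, M j s = M s j) (hdiag : ∀ j, M j j = 0)
    (hmono : ∀ j (S : Finset (Fin n)), j ∉ S → 0 ≤ m j + ∑ s ∈ S, M j s)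
    {P Q : Fin n → ℝ} (i : Fin n) (hi : P i ≤ Q i) (hoff : ∀ j, j ≠ i → P j = Q j) :
    CI2 n m M P ≤ CI2 n m M Q := by
  set d : Fin n → ℝ := fun s => M i s * (min (Q i) (P s) - min (P i) (P s)) with hd
  have hlin : ∑ j, m j * Q j - ∑ j, m j * P j = m i * (Q i - P i) := by
    rw [← sum_sub_distrib, sum_eq_single i]
    · ring
    · intro j _ hj
      rw [hoff j hj, sub_self]
    · simp
  have hterm : ∀ j s, (if j < s then M j s * min (Q j) (Q s) else 0)
      - (if j < s then M j s * min (P j) (P s) else 0)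
      = (if j = i then (if i < s then d s else 0) else 0)
        + (if s = i then (if j < i then d j else 0) else 0) := by
    intro j s
    by_cases hjs : j < s
    · by_cases hj : j = i
      · subst hj
        simp [hjs, hjs.ne', hd, hoff s hjs.ne', mul_sub]
      · by_cases hs : s = i
        · subst hs
          simp [hjs, hj, hd, hoff j hj, mul_sub, hsymm s j, min_comm]
        · simp [hjs, hj, hs, hoff j hj, hoff s hs]
    · have h₁ : ¬(j = i ∧ i < s) := by
        rintro ⟨rfl, h⟩
        exact hjs h
      have h₂ : ¬(s = i ∧ j < i) := by
        rintro ⟨rfl, h⟩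
        exact hjs h
      simp only [← ite_and, h₁, h₂, hjs, if_false, sub_self, add_zero]
  have hpair : (∑ j, ∑ s, if j < s then M j s * min (Q j) (Q s) else 0)
      - (∑ j, ∑ s, if j < s then M j s * min (P j) (P s) else 0) = ∑ s, d s := by
    simp only [← sum_sub_distrib, hterm, sum_add_distrib, sum_ite_eq', mem_univ, if_true]
    rw [sum_comm]
    simp only [sum_ite_eq', mem_univ, if_true, ← sum_add_distrib]
    refine sum_congr rfl fun s _ => ?_
    rcases lt_trichotomy i s with h | rfl | h
    · simp [h, h.not_gt]
    · simp [hd, hdiag]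
    · simp [h, h.not_gt]
  -- Each increment of a minimum lies in `[0, Q i - P i]`, so the worst case is the sum of the
  -- negative interactions with `i`.
  have hbound : ∀ s, (if M i s < 0 then M i s else 0) * (Q i - P i) ≤ d s := by
    intro s
    have h0 : min (P i) (P s) ≤ min (Q i) (P s) := min_le_min_right _ hi
    have h1 : min (Q i) (P s) - min (P i) (P s) ≤ Q i - P i := by
      rcases min_cases (Q i) (P s) with h | h <;> rcases min_cases (P i) (P s) with h' | h' <;>
        linarith
    split_ifs with h
    · exact mul_le_mul_of_nonpos_left h1 h.le
    · rw [zero_mul]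
      exact mul_nonneg (not_lt.mp h) (sub_nonneg.mpr h0)
  have hsum := sum_le_sum fun s (_ : s ∈ univ) => hbound s
  rw [← sum_mul, ← sum_filter] at hsum
  have hnonneg := mul_nonneg (hmono i (univ.filter fun s => M i s < 0) (by simp [hdiag]))
    (sub_nonneg.mpr hi)
  unfold CI2
  linarith

/-- under the Möbius monotonicity condition, the 2-additive Choquet
integral is monotone in its arguments. -/
theorem choquet_monotone (n : ℕ) (m : Fin n → ℝ) (M : Fin n → Fin n → ℝ)
    (hsymm : ∀ j s, M j s = M s j) (hdiag : ∀ j, M j j = 0)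
    (hmono1 : ∀ j, 0 ≤ m j)
    (hmono2 : ∀ j (S : Finset (Fin n)), j ∉ S → 0 ≤ m j + ∑ s ∈ S, M j s)
    (P Q : Fin n → ℝ) (hPQ : ∀ j, P j ≤ Q j) :
    CI2 n m M P ≤ CI2 n m M Q := by
  have key : ∀ T : Finset (Fin n), CI2 n m M P ≤ CI2 n m M (T.piecewise Q P) := by
    intro T
    induction T using Finset.induction_on with
    | empty => simp
    | insert i T hiT ih =>
      refine ih.trans (CI2_le_CI2_of_eq_off hsymm hdiag hmono2 i ?_ fun j hj => ?_)
      · simpa [hiT] using hPQ i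
      · simp [Finset.piecewise, hj]
  simpa using key univ
end

section
/- Let (m, M) be a 2-additive Möbius representation on n criteria satisfying the boundary condition and the monotonicity condition. Then for every vector P : Fin n → ℝ with 0 ≤ P j ≤ 1 for all j, the 2-additive Choquet integral satisfies 0 ≤ CI(P) ≤ 1 (Condition 3.B for the Choquet-outranking degree). -/
open Finset

open Classical in
/-- Summing a symmetric function over the edges of a tournament, twice, gives the sum over all
ordered pairs of distinct vertices. -/
theorem two_mul_sum_tournament {ι : Type*} [Fintype ι] (R : ι → ι → Prop)
    (hirr : ∀ j, ¬ R j j) (htour : ∀ j s, j ≠ s → (R j s ↔ ¬ R s j))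
    (f : ι → ι → ℝ) (hf : ∀ j s, f j s = f s j) :
    2 * ∑ j, ∑ s, (if R j s then f j s else 0) =
      ∑ j, ∑ s, (if j ≠ s then f j s else 0) := by
  have hswap : ∑ j, ∑ s, (if R j s then f j s else 0) =
      ∑ j, ∑ s, (if R s j then f j s else 0) := by
    rw [Finset.sum_comm]
    simp only [hf]
  rw [two_mul]
  nth_rewrite 2 [hswap]
  simp only [← Finset.sum_add_distrib]
  refine Finset.sum_congr rfl fun j _ => Finset.sum_congr rfl fun s _ => ?_
  by_cases h : j = s
  · subst h
    simp [hirr]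
  · have := htour j s h
    by_cases h' : R s j <;> simp_all

open Classical in
/-- The sum of a symmetric function over the edges of a tournament on a linear order does not
depend on the tournament. -/
theorem sum_lt_eq_sum_tournament {ι : Type*} [Fintype ι] [LinearOrder ι] (R : ι → ι → Prop)
    (hirr : ∀ j, ¬ R j j) (htour : ∀ j s, j ≠ s → (R j s ↔ ¬ R s j))
    (f : ι → ι → ℝ) (hf : ∀ j s, f j s = f s j) :
    ∑ j, ∑ s, (if j < s then f j s else 0) = ∑ j, ∑ s, (if R j s then f j s else 0) := by
  have h₁ := two_mul_sum_tournament R hirr htour f hf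
  have h₂ := two_mul_sum_tournament (fun j s : ι => j < s) (fun j => lt_irrefl j)
    (fun j s h => ⟨fun h' => h'.asymm, fun h' => lt_of_le_of_ne (not_lt.mp h') h⟩) f hf
  have h₃ : ∑ j, ∑ s, (if j < s then f j s else 0) =
      ∑ j : ι, ∑ s : ι, (@ite _ (j < s) (Classical.propDecidable _) (f j s) 0) := by
    refine Finset.sum_congr rfl fun j _ => Finset.sum_congr rfl fun s _ => ?_
    congr
  rw [h₃]
  linarith

/-- Condition 3.B: under the boundary and monotonicity conditions, the
2-additive Choquet integral of a vector with entries in [0,1] lies in [0,1]. -/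
theorem choquet_bounded (n : ℕ) (m : Fin n → ℝ) (M : Fin n → Fin n → ℝ)
    (hsymm : ∀ j s, M j s = M s j) (hdiag : ∀ j, M j j = 0)
    (hbound : ∑ j, m j + ∑ j, ∑ s, (if j < s then M j s else 0) = 1)
    (hmono1 : ∀ j, 0 ≤ m j)
    (hmono2 : ∀ j (S : Finset (Fin n)), j ∉ S → 0 ≤ m j + ∑ s ∈ S, M j s)
    (P : Fin n → ℝ) (hP : ∀ j, 0 ≤ P j ∧ P j ≤ 1) :
    0 ≤ CI2 n m M P ∧ CI2 n m M P ≤ 1 := by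
  classical
  let R : Fin n → Fin n → Prop := fun j s => P j < P s ∨ (P j = P s ∧ j < s)
  have hirr : ∀ j, ¬ R j j := fun j => by simp [R]
  have htour : ∀ j s, j ≠ s → (R j s ↔ ¬ R s j) := by
    intro j s h
    simp only [R]
    grind
  have hle : ∀ j s, R j s → P j ≤ P s := by
    rintro j s (h | h)
    exacts [h.le, h.1.le]
  let c : Fin n → ℝ := fun j => m j + ∑ s with R j s, M j s
  have hc : ∀ j, 0 ≤ c j := fun j => hmono2 j _ (by simp [hirr])
  have hsum : ∑ j, c j = 1 := by
    rw [← hbound, sum_lt_eq_sum_tournament R hirr htour M hsymm, ← Finset.sum_add_distrib]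
    refine Finset.sum_congr rfl fun j _ => ?_
    simp only [c, Finset.sum_filter]
    congr!
  have hCI : CI2 n m M P = ∑ j, c j * P j := by
    rw [CI2, sum_lt_eq_sum_tournament R hirr htour (fun j s => M j s * min (P j) (P s))
      (fun j s => by rw [hsymm, min_comm]), ← Finset.sum_add_distrib]
    refine Finset.sum_congr rfl fun j _ => ?_
    simp only [c, Finset.sum_filter, add_mul, Finset.sum_mul]
    congr 1
    refine Finset.sum_congr rfl fun s _ => ?_
    by_cases h : R j s
    · simp [h, hle j s h]
    · simp [h]
  rw [hCI]
  refine ⟨Finset.sum_nonneg fun j _ => mul_nonneg (hc j) (hP j).1, ?_⟩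
  rw [← hsum]
  exact Finset.sum_le_sum fun j _ => mul_le_of_le_one_right (hc j) (hP j).2
end

section
/- Let (m, M) be a 2-additive Möbius representation on n criteria satisfying the boundary condition and the monotonicity condition, and suppose all pair masses are nonnegative (M j s ≥ 0 for all j, s). Let P, Q : Fin n → ℝ take values in [0,1] and have disjoint supports, i.e. for each criterion j, P j = 0 or Q j = 0. Then CI(P) + CI(Q) ≤ 1 (Condition 4.B for the Choquet-outranking degree in the synergy-only case). -/
open Finset

/-- Condition 4.B, synergy-only case: under the boundary and monotonicity
conditions, with nonnegative pair masses, the Choquet integrals of two [0,1]-valued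
vectors with disjoint supports sum to at most 1. -/
theorem choquet_condition_4B (n : ℕ) (m : Fin n → ℝ) (M : Fin n → Fin n → ℝ)
    (hsymm : ∀ j s, M j s = M s j) (hdiag : ∀ j, M j j = 0)
    (hbound : ∑ j, m j + ∑ j, ∑ s, (if j < s then M j s else 0) = 1)
    (hmono1 : ∀ j, 0 ≤ m j)
    (hmono2 : ∀ j (S : Finset (Fin n)), j ∉ S → 0 ≤ m j + ∑ s ∈ S, M j s)
    (hMpos : ∀ j s, 0 ≤ M j s)
    (P Q : Fin n → ℝ)
    (hP : ∀ j, 0 ≤ P j ∧ P j ≤ 1) (hQ : ∀ j, 0 ≤ Q j ∧ Q j ≤ 1)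
    (hdisj : ∀ j, P j = 0 ∨ Q j = 0) :
    CI2 n m M P + CI2 n m M Q ≤ 1 := by
  have hPQ : ∀ j, P j + Q j ≤ 1 := fun j => by
    rcases hdisj j with h | h
    · linarith [(hQ j).2]
    · linarith [(hP j).2]
  have hsingle : ∑ j, m j * P j + ∑ j, m j * Q j ≤ ∑ j, m j := by
    rw [← Finset.sum_add_distrib]
    refine Finset.sum_le_sum fun j _ => ?_
    rw [← mul_add]
    exact mul_le_of_le_one_right (hmono1 j) (hPQ j)
  have hpair : (∑ j, ∑ s, if j < s then M j s * min (P j) (P s) else 0) +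
      (∑ j, ∑ s, if j < s then M j s * min (Q j) (Q s) else 0) ≤
      ∑ j, ∑ s, (if j < s then M j s else 0) := by
    simp only [← Finset.sum_add_distrib]
    refine Finset.sum_le_sum fun j _ => Finset.sum_le_sum fun s _ => ?_
    split_ifs
    · rw [← mul_add]
      exact mul_le_of_le_one_right (hMpos j s)
        ((add_le_add (min_le_left _ _) (min_le_left _ _)).trans (hPQ j))
    · simp
  unfold CI2
  linarith
end

section
/- Let (m, M) be a 2-additive Möbius representation on n criteria satisfying the monotonicity condition, and let π be the Choquet-outranking degree built from evaluations g and preference functions F. Then π satisfies Condition 6.B: for all elements x, y, x', y', if g x j − g y j ≤ g x' j − g y' j for every criterion j, then π(x, y) ≤ π(x', y'). -/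
open Finset

/-- The Choquet-outranking degree of `x` over `y` built from evaluations `g` and
preference functions `F`. -/
noncomputable def outrank {X : Type*} (n : ℕ) (m : Fin n → ℝ) (M : Fin n → Fin n → ℝ)
    (g : X → Fin n → ℝ) (F : Fin n → ℝ → ℝ) (x y : X) : ℝ :=
  CI2 n m M (fun j => F j (g x j - g y j))

/-- The positive Choquet-flow of `x` within the finite set `S`. -/
noncomputable def posFlow {X : Type*} [DecidableEq X] (π : X → X → ℝ)
    (S : Finset X) (x : X) : ℝ :=
  (1 / ((S.card : ℝ) - 1)) * ∑ y ∈ S.erase x, π x y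

/-- The negative Choquet-flow of `x` within the finite set `S`. -/
noncomputable def negFlow {X : Type*} [DecidableEq X] (π : X → X → ℝ)
    (S : Finset X) (x : X) : ℝ :=
  (1 / ((S.card : ℝ) - 1)) * ∑ y ∈ S.erase x, π y x

/-- The net Choquet-flow of `x` within the finite set `S`. -/
noncomputable def netFlow {X : Type*} [DecidableEq X] (π : X → X → ℝ)
    (S : Finset X) (x : X) : ℝ :=
  posFlow π S x - negFlow π S x

/-- If every subfamily of the weights `c`, added to `a`, has nonnegative total, then so has the
combination of `a` and `c` with coefficients `d` and `w i ∈ [0, d]`. -/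
theorem mul_add_sum_mul_nonneg {ι : Type*} (T : Finset ι) (a d : ℝ) (c w : ι → ℝ)
    (hc : ∀ S ⊆ T, 0 ≤ a + ∑ i ∈ S, c i) (hd : 0 ≤ d)
    (hw : ∀ i ∈ T, 0 ≤ w i ∧ w i ≤ d) :
    0 ≤ a * d + ∑ i ∈ T, c i * w i := by
  have hneg : (∑ i ∈ T with c i < 0, c i) * d ≤ ∑ i ∈ T, c i * w i := by
    rw [Finset.sum_mul, Finset.sum_filter]
    refine Finset.sum_le_sum fun i hi => ?_
    obtain ⟨h0, h1⟩ := hw i hi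
    split_ifs with hci
    · exact mul_le_mul_of_nonpos_left h1 hci.le
    · exact mul_nonneg (not_lt.mp hci) h0
  have hsum := mul_nonneg (hc _ (Finset.filter_subset (fun i => c i < 0) T)) hd
  linarith

theorem min_sub_min_left_mem {a b : ℝ} (c : ℝ) (hab : a ≤ b) :
    0 ≤ min b c - min a c ∧ min b c - min a c ≤ b - a := by
  grind

/-- The 2-additive Choquet integral is monotone when the Möbius representation is. -/
theorem CI2_mono (n : ℕ) (m : Fin n → ℝ) (M : Fin n → Fin n → ℝ)
    (hsymm : ∀ j s, M j s = M s j)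
    (hmono : ∀ j (S : Finset (Fin n)), j ∉ S → 0 ≤ m j + ∑ s ∈ S, M j s) :
    Monotone (CI2 n m M) := by
  intro P Q hPQ
  -- Raise the smaller index of each pair first: the increment due to `j` in the pair `{j, s}`.
  let w : Fin n → Fin n → ℝ := fun j s =>
    if j < s then min (Q j) (Q s) - min (P j) (Q s) else min (Q j) (P s) - min (P j) (P s)
  have hw : ∀ j s, 0 ≤ w j s ∧ w j s ≤ Q j - P j := by
    intro j s
    dsimp only [w]
    split_ifs <;> exact min_sub_min_left_mem _ (hPQ j)
  have hpos : 0 ≤ ∑ j, (m j * (Q j - P j) + ∑ s ∈ univ.erase j, M j s * w j s) :=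
    Finset.sum_nonneg fun j _ =>
      mul_add_sum_mul_nonneg _ _ _ _ _
        (fun S hS => hmono j S fun hj => Finset.notMem_erase j _ (hS hj))
        (sub_nonneg.mpr (hPQ j)) fun s _ => hw j s
  have hsplit : ∑ j, ∑ s ∈ univ.erase j, M j s * w j s =
      (∑ j, ∑ s, if j < s then M j s * w j s else 0) +
        ∑ j, ∑ s, if j < s then M j s * w s j else 0 := by
    rw [Finset.sum_comm (f := fun j s => if j < s then M j s * w s j else 0),
      ← Finset.sum_add_distrib]
    refine Finset.sum_congr rfl fun j _ => ?_
    rw [← Finset.sum_add_distrib, ← Finset.filter_ne, Finset.sum_filter]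
    refine Finset.sum_congr rfl fun s _ => ?_
    rcases lt_trichotomy j s with hjs | rfl | hjs
    · simp [hjs, hjs.ne, hjs.not_gt]
    · simp
    · simp [hjs, hjs.ne', hjs.not_gt, hsymm j s]
  have hpair : (∑ j, ∑ s, if j < s then M j s * w j s else 0) +
      (∑ j, ∑ s, if j < s then M j s * w s j else 0) =
      (∑ j, ∑ s, if j < s then M j s * min (Q j) (Q s) else 0) -
        ∑ j, ∑ s, if j < s then M j s * min (P j) (P s) else 0 := by
    simp only [← Finset.sum_add_distrib, ← Finset.sum_sub_distrib]
    refine Finset.sum_congr rfl fun j _ => Finset.sum_congr rfl fun s _ => ?_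
    by_cases hjs : j < s
    · simp only [hjs, if_true, w, hjs.not_gt, if_false, min_comm (Q s) (P j),
        min_comm (P s) (P j)]
      ring
    · simp [hjs]
  rw [Finset.sum_add_distrib, hsplit, hpair] at hpos
  simp only [mul_sub, Finset.sum_sub_distrib] at hpos
  unfold CI2
  linarith

/-- Condition 6.B: the Choquet-outranking degree is monotone with respect
to criterion-wise differences of evaluations. -/
theorem outrank_condition_6B {X : Type*} (n : ℕ)
    (m : Fin n → ℝ) (M : Fin n → Fin n → ℝ)
    (hsymm : ∀ j s, M j s = M s j) (hdiag : ∀ j, M j j = 0)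
    (hmono1 : ∀ j, 0 ≤ m j)
    (hmono2 : ∀ j (S : Finset (Fin n)), j ∉ S → 0 ≤ m j + ∑ s ∈ S, M j s)
    (g : X → Fin n → ℝ) (F : Fin n → ℝ → ℝ)
    (hF1 : ∀ j, Monotone (F j))
    (hF2 : ∀ j d, 0 ≤ F j d ∧ F j d ≤ 1)
    (hF3 : ∀ j d, d ≤ 0 → F j d = 0)
    (x y x' y' : X)
    (h : ∀ j, g x j - g y j ≤ g x' j - g y' j) :
    outrank n m M g F x y ≤ outrank n m M g F x' y' := by
  exact CI2_mono n m M hsymm hmono2 fun j => hF1 j (h j)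
end

section
/- (Property of weak homogeneity.) Let r : Fin (k+1) → X be limiting profiles, all pairwise distinct, and let a and b be alternatives, each distinct from all profiles. Suppose the Choquet-outranking degrees of a and b with respect to the profiles coincide: π(r h, a) = π(r h, b) and π(a, r h) = π(b, r h) for every h. Then, with R_a = {r 0, …, r k, a} and R_b = {r 0, …, r k, b}, one has φ⁺_{R_a}(a) = φ⁺_{R_b}(b), φ⁻_{R_a}(a) = φ⁻_{R_b}(b), φ_{R_a}(a) = φ_{R_b}(b), and for every profile r h: φ⁺_{R_a}(r h) = φ⁺_{R_b}(r h), φ⁻_{R_a}(r h) = φ⁻_{R_b}(r h), and φ_{R_a}(r h) = φ_{R_b}(r h). -/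
open Finset

theorem negFlow_eq_posFlow_flip {X : Type*} [DecidableEq X] (π : X → X → ℝ)
    (S : Finset X) (x : X) : negFlow π S x = posFlow (flip π) S x := rfl

/-- The positive flow of an element added to `R` depends only on its outranking degrees
over the elements of `R`. -/
theorem posFlow_insert_self_congr {X : Type*} [DecidableEq X] {π : X → X → ℝ}
    {R : Finset X} {a b : X} (ha : a ∉ R) (hb : b ∉ R) (h : ∀ y ∈ R, π a y = π b y) :
    posFlow π (insert a R) a = posFlow π (insert b R) b := by
  simp only [posFlow, card_insert_of_notMem ha, card_insert_of_notMem hb,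
    erase_insert ha, erase_insert hb, sum_congr rfl h]

/-- The positive flow of `x ∈ R` does not change when the element added to `R` is replaced
by another one which `x` outranks to the same degree. -/
theorem posFlow_insert_congr {X : Type*} [DecidableEq X] {π : X → X → ℝ}
    {R : Finset X} {a b x : X} (ha : a ∉ R) (hb : b ∉ R) (hx : x ∈ R)
    (h : π x a = π x b) :
    posFlow π (insert a R) x = posFlow π (insert b R) x := by
  have hax : a ≠ x := fun e => ha (e ▸ hx)
  have hbx : b ≠ x := fun e => hb (e ▸ hx)
  have ha' : a ∉ R.erase x := fun e => ha (mem_of_mem_erase e)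
  have hb' : b ∉ R.erase x := fun e => hb (mem_of_mem_erase e)
  simp only [posFlow, card_insert_of_notMem ha, card_insert_of_notMem hb,
    erase_insert_of_ne hax, erase_insert_of_ne hbx, sum_insert ha', sum_insert hb', h]

/-- Property of weak homogeneity: if two alternatives have the same
Choquet-outranking degrees with respect to the reference profiles, then all their
Choquet-flows (and those of the profiles) coincide. -/
theorem weak_homogeneity {X : Type*} [DecidableEq X] (n k : ℕ)
    (m : Fin n → ℝ) (M : Fin n → Fin n → ℝ)
    (hsymm : ∀ j s, M j s = M s j) (hdiag : ∀ j, M j j = 0)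
    (g : X → Fin n → ℝ) (F : Fin n → ℝ → ℝ)
    (hF1 : ∀ j, Monotone (F j))
    (hF2 : ∀ j d, 0 ≤ F j d ∧ F j d ≤ 1)
    (hF3 : ∀ j d, d ≤ 0 → F j d = 0)
    (r : Fin (k + 1) → X)
    (hinj : Function.Injective r)
    (a b : X) (ha : ∀ h, a ≠ r h) (hb : ∀ h, b ≠ r h)
    (hπ1 : ∀ h, outrank n m M g F (r h) a = outrank n m M g F (r h) b)
    (hπ2 : ∀ h, outrank n m M g F a (r h) = outrank n m M g F b (r h)) :
    posFlow (outrank n m M g F) (insert a (Finset.image r Finset.univ)) a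
        = posFlow (outrank n m M g F) (insert b (Finset.image r Finset.univ)) b ∧
      negFlow (outrank n m M g F) (insert a (Finset.image r Finset.univ)) a
        = negFlow (outrank n m M g F) (insert b (Finset.image r Finset.univ)) b ∧
      netFlow (outrank n m M g F) (insert a (Finset.image r Finset.univ)) a
        = netFlow (outrank n m M g F) (insert b (Finset.image r Finset.univ)) b ∧
      ∀ h : Fin (k + 1),
        posFlow (outrank n m M g F) (insert a (Finset.image r Finset.univ)) (r h)
            = posFlow (outrank n m M g F) (insert b (Finset.image r Finset.univ)) (r h) ∧
          negFlow (outrank n m M g F) (insert a (Finset.image r Finset.univ)) (r h)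
            = negFlow (outrank n m M g F) (insert b (Finset.image r Finset.univ)) (r h) ∧
          netFlow (outrank n m M g F) (insert a (Finset.image r Finset.univ)) (r h)
            = netFlow (outrank n m M g F) (insert b (Finset.image r Finset.univ)) (r h) := by
  have ha' : a ∉ Finset.image r Finset.univ := by simpa [eq_comm] using ha
  have hb' : b ∉ Finset.image r Finset.univ := by simpa [eq_comm] using hb
  have hpos := posFlow_insert_self_congr (π := outrank n m M g F) ha' hb' (by simpa using hπ2)
  have hneg := posFlow_insert_self_congr (π := flip (outrank n m M g F)) ha' hb'
    (by simpa [flip] using hπ1)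
  simp only [← negFlow_eq_posFlow_flip] at hneg
  refine ⟨hpos, hneg, by rw [netFlow, netFlow, hpos, hneg], fun h => ?_⟩
  have hr : r h ∈ Finset.image r Finset.univ := by simp
  have hpos' := posFlow_insert_congr ha' hb' hr (hπ1 h)
  have hneg' := posFlow_insert_congr (π := flip (outrank n m M g F)) ha' hb' hr (hπ2 h)
  simp only [← negFlow_eq_posFlow_flip] at hneg'
  exact ⟨hpos', hneg', by rw [netFlow, netFlow, hpos', hneg']⟩
end

section
/- (Dominance lemma for alternatives' positive flows.) Let r : Fin (k+1) → X be limiting profiles, all pairwise distinct, and let a and b be alternatives, each distinct from all profiles. Suppose a dominates b: g a j ≥ g b j for every criterion j. Then, with R_a = {r 0, …, r k, a} and R_b = {r 0, …, r k, b}, the positive Choquet-flows satisfy φ⁺_{R_a}(a) ≥ φ⁺_{R_b}(b). -/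
open Finset

theorem CI2_update_sub {n : ℕ} (m : Fin n → ℝ) {M : Fin n → Fin n → ℝ}
    (hsymm : ∀ j s, M j s = M s j) (hdiag : ∀ j, M j j = 0) (P : Fin n → ℝ) (j : Fin n) (q : ℝ) :
    CI2 n m M (Function.update P j q) - CI2 n m M P =
      m j * (q - P j) + ∑ s, M j s * (min q (P s) - min (P j) (P s)) := by
  have hlin : ∑ i, m i * Function.update P j q i - ∑ i, m i * P i = m j * (q - P j) := by
    rw [← Finset.sum_sub_distrib, Finset.sum_eq_single j]
    · simp [mul_sub]
    · intro i _ hi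
      simp [hi]
    · simp
  have hpair : ∀ i s, ((if i < s then
        M i s * min (Function.update P j q i) (Function.update P j q s) else 0) -
        (if i < s then M i s * min (P i) (P s) else 0)) =
      (if i = j then (if j < s then M j s * (min q (P s) - min (P j) (P s)) else 0) else 0) +
      (if s = j then (if i < j then M j i * (min q (P i) - min (P j) (P i)) else 0) else 0) := by
    intro i s
    by_cases his : i < s
    · by_cases hi : i = j
      · subst hi
        simp [his, his.ne', mul_sub]
      · by_cases hs : s = j
        · subst hs
          simp [his, hi, mul_sub, hsymm i s, min_comm]
        · simp [hi, hs]
    · by_cases hi : i = j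
      · subst hi
        simp [his]
      · by_cases hs : s = j
        · subst hs
          simp [his, hi]
        · simp [hi, hs]
  have hquad : (∑ i, ∑ s, if i < s then
        M i s * min (Function.update P j q i) (Function.update P j q s) else 0) -
        (∑ i, ∑ s, if i < s then M i s * min (P i) (P s) else 0) =
      ∑ s, M j s * (min q (P s) - min (P j) (P s)) := by
    simp_rw [← Finset.sum_sub_distrib, hpair, Finset.sum_add_distrib]
    rw [Finset.sum_comm]
    simp only [Finset.sum_ite_eq', Finset.mem_univ, if_true]
    rw [← Finset.sum_add_distrib]
    refine Finset.sum_congr rfl fun s _ => ?_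
    rcases lt_trichotomy j s with h | h | h
    · simp [h, h.not_gt]
    · simp [← h, hdiag]
    · simp [h, h.not_gt]
  unfold CI2
  linarith

theorem CI2_le_update {n : ℕ} {m : Fin n → ℝ} {M : Fin n → Fin n → ℝ}
    (hsymm : ∀ j s, M j s = M s j) (hdiag : ∀ j, M j j = 0)
    (hmono : ∀ j (S : Finset (Fin n)), j ∉ S → 0 ≤ m j + ∑ s ∈ S, M j s)
    (P : Fin n → ℝ) (j : Fin n) {q : ℝ} (hq : P j ≤ q) :
    CI2 n m M P ≤ CI2 n m M (Function.update P j q) := by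
  rw [← sub_nonneg, CI2_update_sub m hsymm hdiag]
  have hneg := hmono j {s | M j s < 0} (by simp [hdiag])
  have hsum : (∑ s with M j s < 0, M j s) * (q - P j) ≤
      ∑ s, M j s * (min q (P s) - min (P j) (P s)) := by
    rw [Finset.sum_filter, Finset.sum_mul]
    refine Finset.sum_le_sum fun s _ => ?_
    have hlow : 0 ≤ min q (P s) - min (P j) (P s) :=
      sub_nonneg.2 (min_le_min_right _ hq)
    have hupp : min q (P s) - min (P j) (P s) ≤ q - P j := by
      rcases min_cases q (P s) with h | h <;> rcases min_cases (P j) (P s) with h' | h' <;> linarith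
    split_ifs with h
    · exact mul_le_mul_of_nonpos_left hupp h.le
    · rw [zero_mul]
      exact mul_nonneg (not_lt.1 h) hlow
  nlinarith [mul_nonneg hneg (sub_nonneg.2 hq)]

theorem CI2_monotone {n : ℕ} {m : Fin n → ℝ} {M : Fin n → Fin n → ℝ}
    (hsymm : ∀ j s, M j s = M s j) (hdiag : ∀ j, M j j = 0)
    (hmono : ∀ j (S : Finset (Fin n)), j ∉ S → 0 ≤ m j + ∑ s ∈ S, M j s) :
    Monotone (CI2 n m M) := by
  intro P Q hPQ
  have hpiece : ∀ T : Finset (Fin n), CI2 n m M P ≤ CI2 n m M (T.piecewise Q P) := by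
    intro T
    induction T using Finset.induction_on with
    | empty => simp
    | insert j T hj ih =>
      rw [Finset.piecewise_insert]
      refine ih.trans (CI2_le_update hsymm hdiag hmono _ j ?_)
      simpa [hj] using hPQ j
  simpa using hpiece Finset.univ

theorem posFlow_insert {X : Type*} [DecidableEq X] (π : X → X → ℝ) {S : Finset X} {x : X}
    (hx : x ∉ S) : posFlow π (insert x S) x = (1 / (S.card : ℝ)) * ∑ y ∈ S, π x y := by
  simp [posFlow, hx]

/-- Dominance lemma, alternatives' positive flows: if `a` dominates `b`,
then the positive Choquet-flow of `a` in `R_a` is at least that of `b` in `R_b`. -/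
theorem dominance_posFlow_alternatives {X : Type*} [DecidableEq X] (n k : ℕ)
    (m : Fin n → ℝ) (M : Fin n → Fin n → ℝ)
    (hsymm : ∀ j s, M j s = M s j) (hdiag : ∀ j, M j j = 0)
    (hmono1 : ∀ j, 0 ≤ m j)
    (hmono2 : ∀ j (S : Finset (Fin n)), j ∉ S → 0 ≤ m j + ∑ s ∈ S, M j s)
    (g : X → Fin n → ℝ) (F : Fin n → ℝ → ℝ)
    (hF1 : ∀ j, Monotone (F j))
    (hF2 : ∀ j d, 0 ≤ F j d ∧ F j d ≤ 1)
    (hF3 : ∀ j d, d ≤ 0 → F j d = 0)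
    (r : Fin (k + 1) → X)
    (hinj : Function.Injective r)
    (a b : X) (ha : ∀ h, a ≠ r h) (hb : ∀ h, b ≠ r h)
    (hdom : ∀ j, g b j ≤ g a j) :
    posFlow (outrank n m M g F) (insert b (Finset.image r Finset.univ)) b
      ≤ posFlow (outrank n m M g F) (insert a (Finset.image r Finset.univ)) a := by
  rw [posFlow_insert _ (by simpa using fun h => (hb h).symm),
    posFlow_insert _ (by simpa using fun h => (ha h).symm)]
  refine mul_le_mul_of_nonneg_left (Finset.sum_le_sum fun y _ => ?_) (by positivity)
  exact CI2_monotone hsymm hdiag hmono2 fun j => hF1 j (sub_le_sub_right (hdom j) _)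
end

section
/- (Equality of the two Choquet integral formulations.) Let μ be a set function on subsets of Fin n with μ(∅) = 0, and let m be its Möbius transform, m(T) = ∑_{S ⊆ T} (−1)^{|T| − |S|} μ(S). Let g : Fin n → ℝ with g j ≥ 0 for all j, and let σ be any permutation of Fin n such that g(σ 0) ≤ g(σ 1) ≤ … ≤ g(σ (n−1)). Then ∑_{j=0}^{n−1} (g(σ j) − g(σ (j−1))) · μ({σ j, σ (j+1), …, σ (n−1)}) = ∑_{T ⊆ Fin n, T ≠ ∅} m(T) · min_{j ∈ T} g j, where by convention g(σ (−1)) = 0; in particular the left-hand side does not depend on the choice of the sorting permutation σ. -/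
open Finset

/-- Möbius inversion over the subsets of a finite set. -/
theorem sum_powerset_mobius {α : Type*} [DecidableEq α] (N : Finset α) (μ : Finset α → ℝ) :
    ∑ T ∈ N.powerset, ∑ S ∈ T.powerset, (-1 : ℝ) ^ (T.card - S.card) * μ S = μ N := by
  induction N using Finset.induction_on generalizing μ with
  | empty => simp
  | insert a N ha ih =>
    rw [Finset.sum_powerset_insert ha, ← Finset.sum_add_distrib, ← ih fun S => μ (insert a S)]
    refine Finset.sum_congr rfl fun T hT => ?_
    have haT : a ∉ T := fun h => ha (Finset.mem_powerset.mp hT h)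
    rw [Finset.sum_powerset_insert haT, ← add_assoc, ← Finset.sum_add_distrib,
      Finset.sum_eq_zero, zero_add]
    · refine Finset.sum_congr rfl fun S hS => ?_
      have haS : a ∉ S := fun h => haT (Finset.mem_powerset.mp hS h)
      rw [Finset.card_insert_of_notMem haT, Finset.card_insert_of_notMem haS,
        Nat.add_sub_add_right]
    · intro S hS
      have hle := Finset.card_le_card (Finset.mem_powerset.mp hS)
      rw [Finset.card_insert_of_notMem haT, Nat.sub_add_comm hle, pow_succ]
      ring

theorem sum_range_succ_sub_pred (G : ℕ → ℝ) (k : ℕ) :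
    ∑ j ∈ Finset.range (k + 1), (G j - if j = 0 then 0 else G (j - 1)) = G k := by
  induction k with
  | zero => simp
  | succ k ih => rw [Finset.sum_range_succ, ih]; simp

/-- If `σ` sorts `g` in nondecreasing order, then the infimum of `g` over `T` is attained at the
element of `T` of least rank. -/
theorem inf'_eq_apply_min'_of_sorted {n : ℕ} (g : Fin n → ℝ) (σ : Equiv.Perm (Fin n))
    (hσ : ∀ i j : Fin n, i ≤ j → g (σ i) ≤ g (σ j)) (T : Finset (Fin n)) (hT : T.Nonempty) :
    T.inf' hT g = g (σ ((T.image σ.symm).min' (hT.image _))) := by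
  apply le_antisymm
  · apply Finset.inf'_le
    obtain ⟨t, ht, h⟩ := Finset.mem_image.mp ((T.image σ.symm).min'_mem (hT.image _))
    rwa [← h, σ.apply_symm_apply]
  · refine Finset.le_inf' _ _ fun t ht => ?_
    simpa using hσ _ _ ((T.image σ.symm).min'_le _ (Finset.mem_image_of_mem _ ht))

theorem subset_image_filter_le_iff {n : ℕ} (σ : Equiv.Perm (Fin n)) (T : Finset (Fin n))
    (hT : T.Nonempty) (j : ℕ) :
    T ⊆ (Finset.univ.filter (fun i : Fin n => j ≤ (i : ℕ))).image σ ↔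
      j ≤ ((T.image σ.symm).min' (hT.image _) : ℕ) := by
  constructor
  · intro h
    obtain ⟨t, ht, htk⟩ := Finset.mem_image.mp ((T.image σ.symm).min'_mem (hT.image _))
    obtain ⟨i, hi, rfl⟩ := Finset.mem_image.mp (h ht)
    rw [← htk, σ.symm_apply_apply]
    exact (Finset.mem_filter.mp hi).2
  · intro h t ht
    refine Finset.mem_image.mpr ⟨σ.symm t, ?_, σ.apply_symm_apply t⟩
    exact Finset.mem_filter.mpr ⟨Finset.mem_univ _,
      h.trans ((T.image σ.symm).min'_le _ (Finset.mem_image_of_mem _ ht))⟩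

/-- Equality of the two Choquet integral formulations: the sorted-order
formulation of the Choquet integral with respect to `μ` coincides with its Möbius
formulation `∑_{T ≠ ∅} m(T) · min_{j ∈ T} g j`; in particular it does not depend on the
choice of the sorting permutation `σ`. -/
theorem choquet_sorted_eq_mobius (n : ℕ)
    (μ : Finset (Fin n) → ℝ) (hμ : μ ∅ = 0)
    (mo : Finset (Fin n) → ℝ)
    (hmo : ∀ T : Finset (Fin n),
      mo T = ∑ S ∈ T.powerset, (-1 : ℝ) ^ (T.card - S.card) * μ S)
    (g : Fin n → ℝ) (hg : ∀ j, 0 ≤ g j)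
    (σ : Equiv.Perm (Fin n))
    (hσ : ∀ i j : Fin n, i ≤ j → g (σ i) ≤ g (σ j)) :
    ∑ j ∈ Finset.range n,
        ((if h : j < n then g (σ ⟨j, h⟩) else 0)
          - (if j = 0 then 0 else if h : j - 1 < n then g (σ ⟨j - 1, h⟩) else 0))
        * μ ((Finset.univ.filter (fun i : Fin n => j ≤ (i : ℕ))).image σ)
      = ∑ T : Finset (Fin n),
          if hT : T.Nonempty then mo T * T.inf' hT g else 0 := by
  set G : ℕ → ℝ := fun j => if h : j < n then g (σ ⟨j, h⟩) else 0 with hG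
  set N : ℕ → Finset (Fin n) :=
    fun j => (Finset.univ.filter (fun i : Fin n => j ≤ (i : ℕ))).image σ with hN
  change ∑ j ∈ Finset.range n, (G j - if j = 0 then 0 else G (j - 1)) * μ (N j) = _
  have hinv : ∀ A : Finset (Fin n), μ A = ∑ T, if T ⊆ A then mo T else 0 := by
    intro A
    rw [← Finset.sum_filter, ← sum_powerset_mobius A μ]
    refine Finset.sum_congr (by ext; simp) fun T _ => (hmo T).symm
  simp_rw [hinv, Finset.mul_sum]
  rw [Finset.sum_comm]
  refine Finset.sum_congr rfl fun T _ => ?_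
  split_ifs with hT
  · set k := (T.image σ.symm).min' (hT.image _) with hk
    have hrange : (Finset.range n).filter (fun j => j ≤ (k : ℕ)) = Finset.range (k + 1) := by
      ext j
      have := k.isLt
      simp only [Finset.mem_filter, Finset.mem_range]
      omega
    have hsub : ∀ j, T ⊆ N j ↔ j ≤ (k : ℕ) := subset_image_filter_le_iff σ T hT
    simp_rw [hsub, mul_ite, mul_zero]
    rw [← Finset.sum_filter, hrange, ← Finset.sum_mul, sum_range_succ_sub_pred,
      inf'_eq_apply_min'_of_sorted g σ hσ T hT, mul_comm]
    simp [hG, hk]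
  · obtain rfl := Finset.not_nonempty_iff_eq_empty.mp hT
    have hmo_empty : mo ∅ = 0 := by simp [hmo, hμ]
    simp [hmo_empty]
end
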